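/- There exists k₀ such that for all integers k ≥ k₀ the following holds: if F is a k-uniform intersecting family on a finite set X with covering number τ(F) = k, x ∈ X satisfies d(x) ≥ (log k)·k^(k-2) (natural logarithm), and t := ⌊log k⌋, then |{f ∈ F : x ∉ f}| ≤ C(k+t-1, t) · k^(k-t), where C(n, m) denotes the binomial coefficient. -/

import Mathlib

/-- A family of finite sets is intersecting if any two members intersect. -/
def IntersectingFamily {α : Type} [DecidableEq α] (F : Finset (Finset α)) : Prop :=
  ∀ f ∈ F, ∀ g ∈ F, (f ∩ g).Nonempty

/-- The covering number: the least size of a set meeting every member of `F`. -/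
noncomputable def coverNum {α : Type} [DecidableEq α] (F : Finset (Finset α)) : ℕ :=
  sInf {n : ℕ | ∃ C : Finset α, C.card = n ∧ ∀ f ∈ F, (f ∩ C).Nonempty}

/-- The degree of a vertex: the number of members of `F` containing it. -/
def degVert {α : Type} [DecidableEq α] (F : Finset (Finset α)) (x : α) : ℕ :=
  (F.filter fun f => x ∈ f).card

/-- The degree of a set: the number of members of `F` containing it. -/
def degSet {α : Type} [DecidableEq α] (F : Finset (Finset α)) (S : Finset α) : ℕ :=
  (F.filter fun f => S ⊆ f).card

section Branching

variable {α : Type} [DecidableEq α]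

/-- The members of `F` that contain `S` and are disjoint from `T`. -/
def edgesBetween (F : Finset (Finset α)) (S T : Finset α) : Finset (Finset α) :=
  F.filter fun f => S ⊆ f ∧ Disjoint T f

theorem mem_edgesBetween {F : Finset (Finset α)} {S T f : Finset α} :
    f ∈ edgesBetween F S T ↔ f ∈ F ∧ S ⊆ f ∧ Disjoint T f := by
  simp [edgesBetween]

theorem exists_disjoint_of_card_lt_coverNum {F : Finset (Finset α)} {S : Finset α}
    (hS : S.card < coverNum F) : ∃ f ∈ F, Disjoint f S := by
  by_contra! h
  exact (not_le.2 hS) (Nat.sInf_le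
    ⟨S, rfl, fun f hf => Finset.not_disjoint_iff_nonempty_inter.1 (h f hf)⟩)

/-- If `S` is smaller than the covering number, some one-point extension of `S` keeps at least a
`1 / k` proportion of the edges containing `S`. -/
theorem exists_card_edgesBetween_le {F : Finset (Finset α)} {k : ℕ} (hk : 0 < k)
    (hcard : ∀ f ∈ F, f.card = k) (hF : IntersectingFamily F) {S : Finset α}
    (hS : S.card < coverNum F) (T : Finset α) :
    ∃ y ∉ S, (edgesBetween F S T).card ≤ k * (edgesBetween F (insert y S) T).card := by
  obtain ⟨g, hg, hgS⟩ := exists_disjoint_of_card_lt_coverNum hS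
  have hcover : edgesBetween F S T ⊆ g.biUnion fun y => edgesBetween F (insert y S) T := by
    intro f hf
    rw [mem_edgesBetween] at hf
    obtain ⟨y, hy⟩ := hF g hg f hf.1
    rw [Finset.mem_inter] at hy
    simp only [Finset.mem_biUnion, mem_edgesBetween]
    exact ⟨y, hy.1, hf.1, Finset.insert_subset hy.2 hf.2.1, hf.2.2⟩
  have hne : g.Nonempty := by rw [← Finset.card_pos, hcard g hg]; exact hk
  obtain ⟨y, hy, hmax⟩ :=
    g.exists_max_image (fun y => (edgesBetween F (insert y S) T).card) hne
  refine ⟨y, Finset.disjoint_left.1 hgS hy, ?_⟩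
  calc (edgesBetween F S T).card
      ≤ ∑ z ∈ g, (edgesBetween F (insert z S) T).card :=
        (Finset.card_le_card hcover).trans Finset.card_biUnion_le
    _ ≤ g.card • (edgesBetween F (insert y S) T).card := Finset.sum_le_card_nsmul _ _ _ hmax
    _ = k * (edgesBetween F (insert y S) T).card := by rw [hcard g hg, smul_eq_mul]

theorem card_edgesBetween_le_pow {F : Finset (Finset α)} {k : ℕ} (hk : 0 < k)
    (hcard : ∀ f ∈ F, f.card = k) (hF : IntersectingFamily F) (hτ : coverNum F = k)
    (T : Finset α) (n : ℕ) (S : Finset α) (hS : S.card + n = k) :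
    (edgesBetween F S T).card ≤ k ^ n := by
  induction n generalizing S with
  | zero =>
    rw [pow_zero, Finset.card_le_one]
    have heq : ∀ f ∈ edgesBetween F S T, S = f := fun f hf => by
      rw [mem_edgesBetween] at hf
      exact Finset.eq_of_subset_of_card_le hf.2.1 (by rw [hcard f hf.1]; omega)
    intro f hf g hg
    rw [← heq f hf, ← heq g hg]
  | succ n ih =>
    obtain ⟨y, hy, hle⟩ := exists_card_edgesBetween_le hk hcard hF (S := S) (by omega) T
    have := ih (insert y S) (by rw [Finset.card_insert_of_notMem hy]; omega)
    calc _ ≤ _ := hle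
      _ ≤ k * k ^ n := Nat.mul_le_mul_left k this
      _ = k ^ (n + 1) := (pow_succ' k n).symm

/-- Splitting the edges according to whether they contain `y`. -/
theorem card_edgesBetween_le_add (F : Finset (Finset α)) (S T : Finset α) (y : α) :
    (edgesBetween F S T).card ≤
      (edgesBetween F (insert y S) T).card + (edgesBetween F S (insert y T)).card := by
  have hsub : edgesBetween F S T ⊆
      edgesBetween F (insert y S) T ∪ edgesBetween F S (insert y T) := by
    intro f hf
    simp only [Finset.mem_union, mem_edgesBetween, Finset.insert_subset_iff,
      Finset.disjoint_insert_left] at hf ⊢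
    tauto
  exact (Finset.card_le_card hsub).trans (Finset.card_union_le _ _)

/-- The number of edges containing `T` and avoiding `insert x Y`, provided that sufficiently many
edges contain `insert x Y` and avoid `T`. -/
theorem card_edgesBetween_le_multichoose {F : Finset (Finset α)} {k : ℕ} (hk : 0 < k)
    (hcard : ∀ f ∈ F, f.card = k) (hF : IntersectingFamily F) (hτ : coverNum F = k)
    {L : ℝ} {t : ℕ} (htL : (t : ℝ) ≤ L) (htk : t ≤ k) (x : α) (m n : ℕ) (T Y : Finset α)
    (hx : x ∉ Y) (hT : T.card + m = t) (hY : Y.card + 1 + n = k)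
    (hdeg : (L - T.card) * (k : ℝ) ^ (k - 1) ≤
      (k : ℝ) ^ (Y.card + 1) * ((edgesBetween F (insert x Y) T).card : ℝ)) :
    (edgesBetween F T (insert x Y)).card ≤ n.multichoose m * k ^ (k - t) := by
  have hk0 : (0 : ℝ) < k := by exact_mod_cast hk
  induction m generalizing n T Y with
  | zero =>
    rw [Nat.multichoose_zero_right, one_mul]
    exact card_edgesBetween_le_pow hk hcard hF hτ _ _ _ (by omega)
  | succ m ihm =>
    have hlt : (T.card : ℝ) < L := by
      refine lt_of_lt_of_le ?_ htL
      exact_mod_cast (by omega : T.card < t)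
    have hpos : 0 < (edgesBetween F (insert x Y) T).card := by
      have : 0 < (L - T.card) * (k : ℝ) ^ (k - 1) := mul_pos (sub_pos.2 hlt) (pow_pos hk0 _)
      have := pos_of_mul_pos_right (this.trans_le hdeg) (by positivity)
      exact_mod_cast this
    have hScard : (insert x Y).card = Y.card + 1 := Finset.card_insert_of_notMem hx
    induction n generalizing Y with
    | zero =>
      obtain ⟨g, hg⟩ := Finset.card_pos.1 hpos
      rw [mem_edgesBetween] at hg
      have hgS : insert x Y = g :=
        Finset.eq_of_subset_of_card_le hg.2.1 (by rw [hcard g hg.1]; omega)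
      have hempty : edgesBetween F T (insert x Y) = ∅ := by
        refine Finset.eq_empty_of_forall_notMem fun f hf => ?_
        rw [mem_edgesBetween, hgS, Finset.disjoint_iff_inter_eq_empty] at hf
        exact (hF g hg.1 f hf.1).ne_empty hf.2.2
      simp [hempty]
    | succ n ihn =>
      obtain ⟨y, hyS, hle⟩ := exists_card_edgesBetween_le hk hcard hF (S := insert x Y)
        (by omega) T
      have hpos' : 0 < (edgesBetween F (insert y (insert x Y)) T).card :=
        Nat.pos_of_mul_pos_left (hpos.trans_le hle)
      obtain ⟨g, hg⟩ := Finset.card_pos.1 hpos'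
      rw [mem_edgesBetween] at hg
      have hyT : y ∉ T := fun h =>
        Finset.disjoint_left.1 hg.2.2 h (hg.2.1 (Finset.mem_insert_self _ _))
      have hyx : y ≠ x := fun h => hyS (h ▸ Finset.mem_insert_self _ _)
      have hyY : y ∉ Y := fun h => hyS (Finset.mem_insert_of_mem h)
      have hle' : ((edgesBetween F (insert x Y) T).card : ℝ) ≤
          k * ((edgesBetween F (insert y (insert x Y)) T).card : ℝ) := by exact_mod_cast hle
      have hwith : (edgesBetween F (insert y T) (insert x Y)).card ≤
          (n + 1).multichoose m * k ^ (k - t) := by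
        refine ihm (n + 1) (insert y T) Y hx
          (by rw [Finset.card_insert_of_notMem hyT]; omega) hY ?_
        have hsplit : ((edgesBetween F (insert x Y) T).card : ℝ) ≤
            (k : ℝ) ^ n + ((edgesBetween F (insert x Y) (insert y T)).card : ℝ) := by
          have h₁ := card_edgesBetween_le_add F (insert x Y) T y
          have h₂ := card_edgesBetween_le_pow hk hcard hF hτ T n (insert y (insert x Y))
            (by rw [Finset.card_insert_of_notMem hyS]; omega)
          exact_mod_cast h₁.trans (Nat.add_le_add_right h₂ _)
        have hpow : (k : ℝ) ^ (k - 1) = (k : ℝ) ^ (Y.card + 1) * (k : ℝ) ^ n := by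
          rw [← pow_add]; congr 1; omega
        have := mul_le_mul_of_nonneg_left hsplit (by positivity : (0 : ℝ) ≤ (k : ℝ) ^ (Y.card + 1))
        rw [Finset.card_insert_of_notMem hyT]
        push_cast
        linarith
      have hYcard : (insert y Y).card = Y.card + 1 := Finset.card_insert_of_notMem hyY
      have hwithout : (edgesBetween F T (insert y (insert x Y))).card ≤
          n.multichoose (m + 1) * k ^ (k - t) := by
        rw [Finset.insert_comm] at hpos' hle' ⊢
        refine ihn (insert y Y) (by simp [hyx.symm, hx]) (by omega) ?_ hpos'
          (Finset.card_insert_of_notMem (by simp [hyx.symm, hx]))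
        rw [hYcard, pow_succ _ (Y.card + 1), mul_assoc]
        exact hdeg.trans (mul_le_mul_of_nonneg_left hle' (by positivity))
      rw [Nat.multichoose_succ_succ, add_mul]
      exact (card_edgesBetween_le_add F T (insert x Y) y).trans (by omega)

end Branching

/-- binomial-type bound on the number of edges avoiding a high-degree vertex. -/
theorem edges_avoiding_vertex_binomial_bound :
    ∃ k₀ : ℕ, ∀ k : ℕ, k₀ ≤ k →
      ∀ (α : Type) [DecidableEq α] (X : Finset α) (F : Finset (Finset α)),
        (∀ f ∈ F, f ⊆ X) → (∀ f ∈ F, f.card = k) → IntersectingFamily F →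
        coverNum F = k →
        ∀ x ∈ X, Real.log k * (k : ℝ) ^ (k - 2) ≤ (degVert F x : ℝ) →
        (F.filter fun f => x ∉ f).card ≤
          (k + ⌊Real.log k⌋₊ - 1).choose ⌊Real.log k⌋₊ * k ^ (k - ⌊Real.log k⌋₊) := by
  refine ⟨2, fun k hk α _ X F _ hcard hF hτ x _ hd => ?_⟩
  have hk0 : 0 < k := by omega
  have hlog : 0 ≤ Real.log k := Real.log_natCast_nonneg k
  have htL : ((⌊Real.log k⌋₊ : ℕ) : ℝ) ≤ Real.log k := Nat.floor_le hlog
  have htk : ⌊Real.log k⌋₊ ≤ k := by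
    have := Real.log_le_self (Nat.cast_nonneg (α := ℝ) k)
    exact_mod_cast htL.trans this
  have hdeg : (edgesBetween F {x} ∅).card = degVert F x := by
    simp [edgesBetween, degVert]
  have key := card_edgesBetween_le_multichoose hk0 hcard hF hτ htL htk x ⌊Real.log k⌋₊ (k - 1)
    ∅ ∅ (by simp) (by simp) (by simp; omega) (by
      have : (0 : ℝ) ≤ k := Nat.cast_nonneg k
      have hpow : (k : ℝ) ^ (k - 1) = k * (k : ℝ) ^ (k - 2) := by
        rw [← pow_succ']; congr 1; omega
      rw [insert_empty_eq, hdeg, hpow]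
      simp only [Finset.card_empty, Nat.cast_zero, sub_zero, zero_add, pow_one]
      nlinarith [mul_le_mul_of_nonneg_left hd this])
  have heq : edgesBetween F ∅ (insert x ∅) = F.filter fun f => x ∉ f := by
    simp [edgesBetween]
  rw [heq, Nat.multichoose_eq] at key
  exact key.trans (Nat.mul_le_mul_right _ (Nat.choose_le_choose _ (by omega)))
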